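/- For every fixed database D', every quantifier Q ∈ {∀, ∃}, and every chase variant var ∈ {oblivious, restricted, core}, there is a many-one reduction from the class of Q-terminating knowledge bases for the var chase to the class CT^var_{D'Q} of rule sets Σ with ⟨Σ, D'⟩ Q-terminating for the var chase, and vice versa. -/

import Mathlib

/-!
Common formalization framework for "Restricted Chase Termination: You Want More than Fairness"
(Carral, Gerlach, Larroque, Thomazo).

Syntax is encoded over natural numbers so that all finite objects (rules, databases, knowledge
bases, Turing machines) live in `Primcodable` types, which allows us to speak about
many-one reductions and about the arithmetical/analytical hierarchy.
-/

namespace ChaseTermination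

/-! ### Terms, atoms, facts, rules, knowledge bases -/

/-- Ground terms: `Sum.inl c` is the constant `c`, `Sum.inr n` is the null `n`. -/
abbrev GroundTerm : Type := ℕ ⊕ ℕ

/-- Terms of rules: `Sum.inl v` is the variable `v`, `Sum.inr g` a ground term. -/
abbrev RTerm : Type := ℕ ⊕ GroundTerm

/-- A fact: a predicate (coded by a natural number) applied to ground terms. -/
abbrev Fact : Type := ℕ × List GroundTerm

/-- An atom: a predicate applied to terms. -/
abbrev Atom : Type := ℕ × List RTerm

/-- An existential rule, given by its body and its head (lists of atoms);
the universally quantified variables are those occurring in the body, the existentially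
quantified ones are the head variables not occurring in the body. -/
abbrev Rule : Type := List Atom × List Atom

abbrev RuleSet : Type := List Rule

abbrev Database : Type := List Fact

/-- A knowledge base: a (finite) rule set together with a database. -/
abbrev KB : Type := RuleSet × Database

def atomHasVar (a : Atom) (v : ℕ) : Prop := (Sum.inl v : RTerm) ∈ a.2

def atomNullFree (a : Atom) : Prop := ∀ t ∈ a.2, ∀ n : ℕ, t ≠ Sum.inr (Sum.inr n)

def factNullFree (f : Fact) : Prop := ∀ t ∈ f.2, ∀ n : ℕ, t ≠ Sum.inr n

/-- A database is a finite fact set without nulls. -/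
def IsDatabase (D : Database) : Prop := ∀ f ∈ D, factNullFree f

/-- Well-formed rule: non-empty head, no nulls. -/
def IsRule (r : Rule) : Prop := r.2 ≠ [] ∧ ∀ a ∈ r.1 ++ r.2, atomNullFree a

def IsRuleSet (S : RuleSet) : Prop := ∀ r ∈ S, IsRule r

def IsKB (kb : KB) : Prop := IsRuleSet kb.1 ∧ IsDatabase kb.2

/-- `v` occurs in the body of `r` (i.e. is universally quantified). -/
def bodyVar (r : Rule) (v : ℕ) : Prop := ∃ a ∈ r.1, atomHasVar a v

/-- `v` is an existential variable of `r`. -/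
def existVar (r : Rule) (v : ℕ) : Prop := (∃ a ∈ r.2, atomHasVar a v) ∧ ¬ bodyVar r v

def applyT (σ : ℕ → GroundTerm) : RTerm → GroundTerm
  | Sum.inl v => σ v
  | Sum.inr g => g

def applyA (σ : ℕ → GroundTerm) (a : Atom) : Fact := (a.1, a.2.map (applyT σ))

/-- A trigger: a rule together with a substitution for its (universal) variables. -/
abbrev Trigger : Type := Rule × (ℕ → GroundTerm)

/-- The support of a trigger: the instantiated body. -/
def support (t : Trigger) : Set Fact := {f | ∃ a ∈ t.1.1, f = applyA t.2 a}

/-- A trigger is loaded for `F` if `F` includes its support. -/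
def loaded (t : Trigger) (F : Set Fact) : Prop := ∀ a ∈ t.1.1, applyA t.2 a ∈ F

/-- `σ'` agrees with the substitution of `t` on all universally quantified (body) variables. -/
def agreesOnBody (t : Trigger) (σ' : ℕ → GroundTerm) : Prop :=
  ∀ v, bodyVar t.1 v → σ' v = t.2 v

/-- A trigger is obsolete for `F` if some extension of its substitution to the existential
variables sends the head into `F`. -/
def obsolete (t : Trigger) (F : Set Fact) : Prop :=
  ∃ σ' : ℕ → GroundTerm, agreesOnBody t σ' ∧ ∀ a ∈ t.1.2, applyA σ' a ∈ F

/-- The (ground) terms occurring in a fact set. -/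
def termsOf (F : Set Fact) : Set GroundTerm := {g | ∃ f ∈ F, g ∈ f.2}

/-- `σ'` is a proper output extension of the trigger `t` w.r.t. `F`: it agrees with the trigger
substitution on body variables and maps existential variables to pairwise distinct fresh nulls. -/
def properExt (t : Trigger) (F : Set Fact) (σ' : ℕ → GroundTerm) : Prop :=
  agreesOnBody t σ' ∧
  (∀ v, existVar t.1 v → ∃ n : ℕ, σ' v = Sum.inr n ∧ (Sum.inr n : GroundTerm) ∉ termsOf F) ∧
  (∀ v w, existVar t.1 v → existVar t.1 w → σ' v = σ' w → v = w)

/-- The output of a trigger under an extended substitution. -/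
def outputOf (t : Trigger) (σ' : ℕ → GroundTerm) : Set Fact := {f | ∃ a ∈ t.1.2, f = applyA σ' a}

/-- An active trigger of `S` for `F`: loaded and not obsolete. -/
def Active (S : RuleSet) (F : Set Fact) (t : Trigger) : Prop :=
  t.1 ∈ S ∧ loaded t F ∧ ¬ obsolete t F

/-- One restricted chase step. -/
def ChaseStep (S : RuleSet) (F F' : Set Fact) : Prop :=
  ∃ t : Trigger, Active S F t ∧ ∃ σ', properExt t F σ' ∧ F' = F ∪ outputOf t σ'

def dbSet (D : Database) : Set Fact := {f | f ∈ D}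

/-- A (possibly infinite) restricted chase derivation for `⟨S, D⟩`, of length `len ∈ ℕ∞`.
Beyond the length the fact sets stall, so that the result is always `⋃ i, fact i`. -/
structure Chase (S : RuleSet) (D : Set Fact) where
  len : ℕ∞
  fact : ℕ → Set Fact
  trig : ℕ → Trigger
  ext : ℕ → ℕ → GroundTerm
  init : fact 0 = D
  activeAt : ∀ i : ℕ, (i : ℕ∞) < len → Active S (fact i) (trig i)
  extOk : ∀ i : ℕ, (i : ℕ∞) < len → properExt (trig i) (fact i) (ext i)
  succ : ∀ i : ℕ, (i : ℕ∞) < len → fact (i + 1) = fact i ∪ outputOf (trig i) (ext i)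
  stall : ∀ i : ℕ, ¬ ((i : ℕ∞) < len) → fact (i + 1) = fact i

/-- Fairness: every trigger that becomes loaded is eventually obsolete.
A fair chase derivation is a *restricted chase sequence*; note that for a finite derivation
fairness forces maximality (no active trigger remains at the end). -/
def Fair {S : RuleSet} {D : Set Fact} (c : Chase S D) : Prop :=
  ∀ t : Trigger, t.1 ∈ S → ∀ i : ℕ, loaded t (c.fact i) → ∃ j : ℕ, i ≤ j ∧ obsolete t (c.fact j)

/-- The result of a chase derivation. -/
def chaseResult {S : RuleSet} {D : Set Fact} (c : Chase S D) : Set Fact := ⋃ i, c.fact i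

/-- The derivation is infinite (non-terminating). -/
def IsInfinite {S : RuleSet} {D : Set Fact} (c : Chase S D) : Prop := c.len = ⊤

/-- `TKR∀`: knowledge bases all of whose restricted chase sequences are finite. -/
def TKRall (kb : KB) : Prop :=
  IsKB kb ∧ ¬ ∃ c : Chase kb.1 (dbSet kb.2), IsInfinite c ∧ Fair c

/-- `TRR∀`: rule sets universally terminating for the restricted chase on every database. -/
def TRRall (S : RuleSet) : Prop :=
  IsRuleSet S ∧ ∀ D : Database, IsDatabase D → ¬ ∃ c : Chase S (dbSet D), IsInfinite c ∧ Fair c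

/-! ### Breadth-first chase -/

/-- The instance of a trigger: its rule together with its instantiated body (this determines the
substitution on all body variables). -/
def instOf (t : Trigger) : Rule × List Fact := (t.1, t.1.1.map (applyA t.2))

/-- The set of instances of active triggers (this is what "the number of triggers that are loaded
and not obsolete" counts). -/
def activeInsts (S : RuleSet) (F : Set Fact) : Set (Rule × List Fact) :=
  {p | ∃ t : Trigger, Active S F t ∧ p = instOf t}

/-- The breadth-first condition (†): a trigger loaded at step `i` becomes obsolete within the
next `n` steps, where `n` is the number of active triggers at step `i`. -/
def BreadthFirst {S : RuleSet} {D : Set Fact} (c : Chase S D) : Prop :=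
  ∀ i : ℕ, ∀ t : Trigger, t.1 ∈ S → loaded t (c.fact i) →
    ∃ j : ℕ, i ≤ j ∧ j ≤ i + (activeInsts S (c.fact i)).ncard ∧ obsolete t (c.fact j)

/-- `TKRBF∀`: knowledge bases all of whose breadth-first chase sequences are finite. -/
def TKRBFall (kb : KB) : Prop :=
  IsKB kb ∧ ¬ ∃ c : Chase kb.1 (dbSet kb.2), IsInfinite c ∧ BreadthFirst c

/-- `TRRBF∀`: rule sets whose breadth-first chase terminates on every database. -/
def TRRBFall (S : RuleSet) : Prop :=
  IsRuleSet S ∧ ∀ D : Database, IsDatabase D →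
    ¬ ∃ c : Chase S (dbSet D), IsInfinite c ∧ BreadthFirst c

/-! ### Classes of the arithmetical and analytical hierarchies -/

/-- `Π⁰₂` predicates, via the Kleene normal form `∀ m ∃ k. R`. -/
def Pi02 {α : Type} [Primcodable α] (p : α → Prop) : Prop :=
  ∃ R : α × ℕ → ℕ → Bool, Computable₂ R ∧ ∀ a, p a ↔ ∀ m : ℕ, ∃ k : ℕ, R (a, m) k = true

/-- `Π¹₁` predicates, via the Kleene normal form: `p a` iff for every function `f : ℕ → ℕ` some
finite initial segment of `f` witnesses a computable predicate. -/
def Pi11 {α : Type} [Primcodable α] (p : α → Prop) : Prop :=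
  ∃ R : α → List ℕ → Bool, Computable₂ R ∧
    ∀ a, p a ↔ ∀ f : ℕ → ℕ, ∃ k : ℕ, R a ((List.range k).map f) = true

/-- `Π¹₁`-hardness: every `Π¹₁` problem many-one reduces to `p`. -/
def Pi11Hard {α : Type} [Primcodable α] (p : α → Prop) : Prop :=
  ∀ q : ℕ → Prop, Pi11 q → q ≤₀ p

def Pi11Complete {α : Type} [Primcodable α] (p : α → Prop) : Prop := Pi11 p ∧ Pi11Hard p

/-! ### Non-deterministic Turing machines -/

/-- A non-deterministic Turing machine `(numStates, alphaSize, table)`.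
States are `0, …, numStates - 1` with initial state `0`; tape symbols `0, …, alphaSize - 1`
form `Γ` (so `{0,1} ⊆ Γ` iff `2 ≤ alphaSize`), and the blank `B` is coded by `alphaSize`.
An entry `((q, a), (q', b, d))` means `(q', b, d) ∈ δ(q, a)`, with `d = true` for a right move
and `d = false` for a left move. -/
abbrev NTM : Type := ℕ × ℕ × List ((ℕ × ℕ) × (ℕ × ℕ × Bool))

def NTM.numStates (M : NTM) : ℕ := M.1
def NTM.blank (M : NTM) : ℕ := M.2.1
def NTM.table (M : NTM) : List ((ℕ × ℕ) × (ℕ × ℕ × Bool)) := M.2.2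

/-- Well-formedness: `Γ ⊇ {0,1}`, transitions use valid states and symbols, and the machine
never writes the blank. -/
def NTM.WF (M : NTM) : Prop :=
  1 ≤ NTM.numStates M ∧ 2 ≤ NTM.blank M ∧
    ∀ e ∈ NTM.table M, e.1.1 < NTM.numStates M ∧ e.1.2 ≤ NTM.blank M ∧
      e.2.1 < NTM.numStates M ∧ e.2.2.1 < NTM.blank M

/-- A configuration `(tape, p, q)`: tape contents (a list of symbol codes whose last cell is
blank and in which no proper symbol occurs after a blank), 0-based head position `p`,
and current state `q`. -/
abbrev Config : Type := List ℕ × ℕ × ℕ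

def WFConfig (M : NTM) (ρ : Config) : Prop :=
  ρ.2.1 < ρ.1.length ∧ ρ.1.getLast? = some (NTM.blank M) ∧
    (∀ i j : ℕ, i ≤ j → j < ρ.1.length → ρ.1.getD i 0 = NTM.blank M →
      ρ.1.getD j 0 = NTM.blank M) ∧
    (∀ a ∈ ρ.1, a ≤ NTM.blank M) ∧ ρ.2.2 < NTM.numStates M

/-- The one-step relation `Next_M` between configurations; each step extends the represented
part of the tape by one blank cell. -/
def NTM.Next (M : NTM) (ρ ρ' : Config) : Prop :=
  ∃ q' b : ℕ, ∃ d : Bool,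
    ((ρ.2.2, ρ.1.getD ρ.2.1 0), (q', b, d)) ∈ NTM.table M ∧
    (d = true ∨ 1 ≤ ρ.2.1) ∧
    ρ' = (ρ.1.set ρ.2.1 b ++ [NTM.blank M], if d then ρ.2.1 + 1 else ρ.2.1 - 1, q')

/-- The starting configuration of `M` on a word. -/
def startConfig (M : NTM) (w : List ℕ) : Config := (w ++ [NTM.blank M], 0, 0)

/-- Words are over the input alphabet `{0, 1}`. -/
def IsWord (w : List ℕ) : Prop := ∀ a ∈ w, a < 2

/-- There is a run of `M` starting in `ρ` that visits the state `qr` infinitely often.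
(Such a run is necessarily infinite, and every infinite sequence of `Next_M`-successive
configurations is a run; finite runs trivially feature `qr` only finitely many times.) -/
def RecurringFrom (M : NTM) (qr : ℕ) (ρ : Config) : Prop :=
  ∃ c : ℕ → Config, c 0 = ρ ∧ (∀ i, NTM.Next M (c i) (c (i + 1))) ∧
    ∀ N : ℕ, ∃ i : ℕ, N ≤ i ∧ (c i).2.2 = qr

/-- `M` is non-recurring through `qr` on the configuration `ρ`: every run of `M` on `ρ`
features `qr` only finitely many times. -/
def NonRecurringFrom (M : NTM) (qr : ℕ) (ρ : Config) : Prop := ¬ RecurringFrom M qr ρ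

end ChaseTermination
namespace ChaseTermination

/-! ### The rule set `Σ_M` of Section 4 and the databases `D_ρ` -/

/-- Predicate codes. `pF`, `pR` are the ternary time/tape successor predicates. -/
def pF : ℕ := 0
def pR : ℕ := 1
def pCL : ℕ := 2
def pCR : ℕ := 3
def pReal : ℕ := 4
def pBrake : ℕ := 5
def pNextBr : ℕ := 6
def pEnd : ℕ := 7
/-- The binary letter predicate for the tape symbol `a`. -/
def pLetter (a : ℕ) : ℕ := 8 + 2 * a
/-- The binary state predicate for the state `q`. -/
def pState (q : ℕ) : ℕ := 9 + 2 * q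

/-- Variable codes used in the rules: `x, y, x', y', w, w'` are `0, …, 5`. -/
def tv (v : ℕ) : RTerm := Sum.inl v

def A1 (p : ℕ) (s : RTerm) : Atom := (p, [s])
def A2 (p : ℕ) (s t : RTerm) : Atom := (p, [s, t])
def A3 (p : ℕ) (s t u : RTerm) : Atom := (p, [s, t, u])

/-- `brSet(x, w)` as atoms: `{F(x,w,w), R(x,w,w), Real(x), Brake(w)}`. -/
def brSetA (x w : RTerm) : List Atom := [A3 pF x w w, A3 pR x w w, A1 pReal x, A1 pBrake w]

/-- Tape alphabet including the blank: `Γ ∪ {B}`. -/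
def letters (M : NTM) : List ℕ := List.range (NTM.blank M + 1)
def states (M : NTM) : List ℕ := List.range (NTM.numStates M)

/-- The rule `R_Brake`. -/
def ruleBrake (M : NTM) : Rule :=
  ([A1 pBrake (tv 4)],
    ((letters M).map fun a => A2 (pLetter a) (tv 4) (tv 4)) ++
    ((states M).map fun q => A2 (pState q) (tv 4) (tv 4)) ++
    [A3 pF (tv 4) (tv 4) (tv 4), A3 pR (tv 4) (tv 4) (tv 4),
     A2 pCL (tv 4) (tv 4), A2 pCR (tv 4) (tv 4), A1 pReal (tv 4), A2 pNextBr (tv 4) (tv 4)])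

/-- The rule `R_nextBr`. -/
def ruleNextBr : Rule :=
  (brSetA (tv 0) (tv 4) ++ [A2 pNextBr (tv 4) (tv 5)], brSetA (tv 0) (tv 5))

/-- Transition rule for `(q', b, →) ∈ δ(q, a)` and the letter `c`; if `q = qr` a fresh
brake `w'` is created together with a `nextBr`-atom, otherwise the brake `w` is reused. -/
def mkTransRight (qr q a q' b c : ℕ) : Rule :=
  ([A2 (pState q) (tv 0) (tv 4), A2 (pLetter a) (tv 0) (tv 4), A3 pR (tv 0) (tv 1) (tv 4),
    A2 (pLetter c) (tv 1) (tv 4)] ++ brSetA (tv 0) (tv 4) ++ brSetA (tv 1) (tv 4),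
   if q = qr then
     [A2 (pState q') (tv 3) (tv 5), A2 (pLetter c) (tv 3) (tv 5), A2 (pLetter b) (tv 2) (tv 5),
      A3 pR (tv 2) (tv 3) (tv 5), A3 pF (tv 0) (tv 2) (tv 5), A3 pF (tv 1) (tv 3) (tv 5),
      A2 pCL (tv 2) (tv 5), A2 pCR (tv 3) (tv 5)] ++
      brSetA (tv 2) (tv 5) ++ brSetA (tv 3) (tv 5) ++ [A2 pNextBr (tv 4) (tv 5)]
   else
     [A2 (pState q') (tv 3) (tv 4), A2 (pLetter c) (tv 3) (tv 4), A2 (pLetter b) (tv 2) (tv 4),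
      A3 pR (tv 2) (tv 3) (tv 4), A3 pF (tv 0) (tv 2) (tv 4), A3 pF (tv 1) (tv 3) (tv 4),
      A2 pCL (tv 2) (tv 4), A2 pCR (tv 3) (tv 4)] ++ brSetA (tv 2) (tv 4) ++ brSetA (tv 3) (tv 4))

/-- Transition rule for `(q', b, ←) ∈ δ(q, a)` and the letter `c`. -/
def mkTransLeft (qr q a q' b c : ℕ) : Rule :=
  ([A2 (pState q) (tv 0) (tv 4), A2 (pLetter a) (tv 0) (tv 4), A3 pR (tv 1) (tv 0) (tv 4),
    A2 (pLetter c) (tv 1) (tv 4)] ++ brSetA (tv 0) (tv 4) ++ brSetA (tv 1) (tv 4),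
   if q = qr then
     [A2 (pState q') (tv 3) (tv 5), A2 (pLetter c) (tv 3) (tv 5), A2 (pLetter b) (tv 2) (tv 5),
      A3 pR (tv 3) (tv 2) (tv 5), A3 pF (tv 0) (tv 2) (tv 5), A3 pF (tv 1) (tv 3) (tv 5),
      A2 pCL (tv 3) (tv 5), A2 pCR (tv 2) (tv 5)] ++
      brSetA (tv 2) (tv 5) ++ brSetA (tv 3) (tv 5) ++ [A2 pNextBr (tv 4) (tv 5)]
   else
     [A2 (pState q') (tv 3) (tv 4), A2 (pLetter c) (tv 3) (tv 4), A2 (pLetter b) (tv 2) (tv 4),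
      A3 pR (tv 3) (tv 2) (tv 4), A3 pF (tv 0) (tv 2) (tv 4), A3 pF (tv 1) (tv 3) (tv 4),
      A2 pCL (tv 3) (tv 4), A2 pCR (tv 2) (tv 4)] ++ brSetA (tv 2) (tv 4) ++ brSetA (tv 3) (tv 4))

/-- All transition rules of `Σ_M` (one per table entry and letter `c`). -/
def transRules (M : NTM) (qr : ℕ) : List Rule :=
  (NTM.table M).foldr (fun e acc =>
    ((letters M).map fun cc =>
      if e.2.2.2 = true then mkTransRight qr e.1.1 e.1.2 e.2.1 e.2.2.1 cc
      else mkTransLeft qr e.1.1 e.1.2 e.2.1 e.2.2.1 cc) ++ acc) []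

/-- The rule `R_{C_R}` for the letter `a`. -/
def mkCopyRight (a : ℕ) : Rule :=
  ([A2 pCR (tv 2) (tv 5), A3 pF (tv 0) (tv 2) (tv 5), A3 pR (tv 0) (tv 1) (tv 4),
    A2 (pLetter a) (tv 1) (tv 4)] ++
    brSetA (tv 0) (tv 4) ++ brSetA (tv 2) (tv 5) ++ brSetA (tv 1) (tv 4),
   [A3 pF (tv 1) (tv 3) (tv 5), A3 pR (tv 2) (tv 3) (tv 5), A2 (pLetter a) (tv 3) (tv 5),
    A2 pCR (tv 3) (tv 5)] ++ brSetA (tv 3) (tv 5))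

/-- The rule `R_{C_L}` for the letter `a`. -/
def mkCopyLeft (a : ℕ) : Rule :=
  ([A2 pCL (tv 2) (tv 5), A3 pF (tv 0) (tv 2) (tv 5), A3 pR (tv 1) (tv 0) (tv 4),
    A2 (pLetter a) (tv 1) (tv 4)] ++
    brSetA (tv 0) (tv 4) ++ brSetA (tv 2) (tv 5) ++ brSetA (tv 1) (tv 4),
   [A3 pF (tv 1) (tv 3) (tv 5), A3 pR (tv 3) (tv 2) (tv 5), A2 (pLetter a) (tv 3) (tv 5),
    A2 pCL (tv 3) (tv 5)] ++ brSetA (tv 3) (tv 5))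

def copyRightRules (M : NTM) : List Rule := (letters M).map mkCopyRight
def copyLeftRules (M : NTM) : List Rule := (letters M).map mkCopyLeft

/-- The tape-extension rule `R_End`. -/
def ruleEnd (M : NTM) : Rule :=
  ([A2 pCR (tv 2) (tv 5), A3 pF (tv 0) (tv 2) (tv 5), A2 pEnd (tv 0) (tv 4)] ++
    brSetA (tv 0) (tv 4) ++ brSetA (tv 2) (tv 5),
   [A3 pR (tv 2) (tv 3) (tv 5), A2 (pLetter (NTM.blank M)) (tv 3) (tv 5),
    A2 pEnd (tv 3) (tv 5)] ++ brSetA (tv 3) (tv 5))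

/-- The rule set `Σ_M` of Section 4 (simulating `M`, with the designated state `qr`). -/
def SigmaM (M : NTM) (qr : ℕ) : RuleSet :=
  [ruleBrake M, ruleNextBr] ++ transRules M qr ++
    copyLeftRules M ++ copyRightRules M ++ [ruleEnd M]

/-- The constant `c_i` (0-based). -/
def cst (i : ℕ) : GroundTerm := Sum.inl (i + 1)
/-- The brake constant `w₁` of the database. -/
def w1 : GroundTerm := Sum.inl 0

/-- `brSet(x, w)` as facts. -/
def brSetF (x w : GroundTerm) : List Fact :=
  [(pF, [x, w, w]), (pR, [x, w, w]), (pReal, [x]), (pBrake, [w])]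

/-- The database `D_ρ` encoding a configuration `ρ`. -/
def Drho (M : NTM) (ρ : Config) : Database :=
  ((List.range ρ.1.length).map fun i => ((pR, [cst i, cst (i + 1), w1]) : Fact)) ++
  ((List.range ρ.1.length).map fun i => ((pLetter (ρ.1.getD i 0), [cst i, w1]) : Fact)) ++
  [((pState ρ.2.2, [cst ρ.2.1, w1]) : Fact),
   ((pLetter (NTM.blank M), [cst ρ.1.length, w1]) : Fact),
   ((pEnd, [cst ρ.1.length, w1]) : Fact)] ++
  (List.range (ρ.1.length + 1)).foldr (fun i acc => brSetF (cst i) w1 ++ acc) []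

/-! ### Wild frontiers -/

/-- The atoms explicitly required by the wild-frontier condition ("other" atoms are those
not in this set). -/
def wfListed (M : NTM) (ρ : Config) (w : GroundTerm) (x : ℕ → GroundTerm) : Set Fact :=
  {f | (∃ i < ρ.1.length,
          f = ((pR, [x i, x (i + 1), w]) : Fact) ∨
          f = ((pLetter (ρ.1.getD i 0), [x i, w]) : Fact)) ∨
    f = ((pState ρ.2.2, [x ρ.2.1, w]) : Fact) ∨
    f = ((pEnd, [x ρ.1.length, w]) : Fact) ∨
    f = ((pLetter (NTM.blank M), [x ρ.1.length, w]) : Fact) ∨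
    (∃ i ≤ ρ.1.length, f ∈ brSetF (x i) w)}

/-- `F` has a wild frontier of the configuration `ρ` overseen by `w` (Definition 4.4). -/
def WildFrontier (M : NTM) (F : Set Fact) (ρ : Config) (w : GroundTerm) : Prop :=
  ∃ x : ℕ → GroundTerm,
    ((pReal, [w]) : Fact) ∉ F ∧
    (∀ i < ρ.1.length, ((pR, [x i, x (i + 1), w]) : Fact) ∈ F ∧
      ((pLetter (ρ.1.getD i 0), [x i, w]) : Fact) ∈ F) ∧
    ((pState ρ.2.2, [x ρ.2.1, w]) : Fact) ∈ F ∧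
    ((pEnd, [x ρ.1.length, w]) : Fact) ∈ F ∧
    ((pLetter (NTM.blank M), [x ρ.1.length, w]) : Fact) ∈ F ∧
    (∀ i ≤ ρ.1.length, ∀ f ∈ brSetF (x i) w, f ∈ F) ∧
    (∀ f ∈ F, f ∉ wfListed M ρ w x →
      ∀ i ≤ ρ.1.length, f.2.head? = some (x i) → f.2[1]? = some w)

/-! ### State atoms, generation, bow ties -/

/-- `g` is a brake of `F`. -/
def isBrake (F : Set Fact) (g : GroundTerm) : Prop := ((pBrake, [g]) : Fact) ∈ F

/-- A state atom of `F`: an atom `q(x, w)` with `q` a state of `M` and `x` not a brake. -/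
def StateAtom (M : NTM) (F : Set Fact) (f : Fact) : Prop :=
  ∃ q : ℕ, q < NTM.numStates M ∧ ∃ x wb : GroundTerm,
    f = ((pState q, [x, wb]) : Fact) ∧ f ∈ F ∧ ¬ isBrake F x

/-- `A` precedes `A'` in the derivation `c`: some applied trigger has `A` in its support
and `A'` in its output. -/
def precedes {S : RuleSet} {D : Set Fact} (c : Chase S D) (A A' : Fact) : Prop :=
  ∃ i : ℕ, (i : ℕ∞) < c.len ∧ A ∈ support (c.trig i) ∧ A' ∈ outputOf (c.trig i) (c.ext i)

/-- The fact `f` is generated (newly produced) at step `i` of the derivation `c`. -/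
def generatedAt {S : RuleSet} {D : Set Fact} (c : Chase S D) (i : ℕ) (f : Fact) : Prop :=
  (i : ℕ∞) < c.len ∧ f ∈ outputOf (c.trig i) (c.ext i) ∧ f ∉ c.fact i

/-- The fact `f` is generated by (an application of) one of the rules in `Rs`. -/
def generatedBy {S : RuleSet} {D : Set Fact} (c : Chase S D) (Rs : List Rule) (f : Fact) : Prop :=
  ∃ i : ℕ, generatedAt c i f ∧ (c.trig i).1 ∈ Rs

/-- Semantically meaningful terms: all terms of `F` except the brakes. -/
def semterms (F : Set Fact) : Set GroundTerm := {g | g ∈ termsOf F ∧ ¬ isBrake F g}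

/-- The edge relation `E_R`: `(x, y) ∈ E_R` iff `R(x, y, w) ∈ F` for some `w`. -/
def ER (F : Set Fact) (u v : GroundTerm) : Prop := ∃ w, ((pR, [u, v, w]) : Fact) ∈ F

/-- The weakly connected component of `x` in the graph induced by `E` on the vertex set `V`. -/
def wcc {α : Type} (V : Set α) (E : α → α → Prop) (x : α) : Set α :=
  {z | z ∈ V ∧ Relation.ReflTransGen (fun u v => u ∈ V ∧ v ∈ V ∧ (E u v ∨ E v u)) x z}

/-- Directed tree rooted in `r` on the vertex set `V` with edge relation `E`. -/
def IsDirTree {α : Type} (V : Set α) (E : α → α → Prop) (r : α) : Prop :=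
  r ∈ V ∧
  (∀ v ∈ V, Relation.ReflTransGen (fun u v' => u ∈ V ∧ v' ∈ V ∧ E u v') r v) ∧
  (∀ v ∈ V, v ≠ r → ∃! u, u ∈ V ∧ E u v) ∧
  (∀ u ∈ V, ¬ E u r)

/-- A bow tie with center `(x, y)` (Definition 6.2): `V_x^{-y}` induces a directed tree on the
inverse edges rooted in `x`, `V_y^{-x}` induces a directed tree rooted in `y`, and the two
components partition `V`. -/
def IsBowTie {α : Type} (V : Set α) (E : α → α → Prop) (x y : α) : Prop :=
  x ∈ V ∧ y ∈ V ∧ E x y ∧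
  IsDirTree (wcc (V \ {y}) E x) (fun u v => E v u) x ∧
  IsDirTree (wcc (V \ {x}) E y) E y ∧
  wcc (V \ {y}) E x ∩ wcc (V \ {x}) E y = ∅ ∧
  wcc (V \ {y}) E x ∪ wcc (V \ {x}) E y = V

/-- `bowtie(A)` for a state atom `q(x, w)`: the weakly connected component of `x` in
`(semterms F, E_R)`. -/
def bowtieOf (F : Set Fact) (x : GroundTerm) : Set GroundTerm := wcc (semterms F) (ER F) x

/-- A maximal `E`-path in the vertex set `V`. -/
def IsMaxPath {α : Type} (V : Set α) (E : α → α → Prop) (l : List α) : Prop :=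
  l ≠ [] ∧ (∀ z ∈ l, z ∈ V) ∧ List.Chain' E l ∧
  (∀ z ∈ V, ∀ a, l.head? = some a → ¬ E z a) ∧
  (∀ z ∈ V, ∀ a, l.getLast? = some a → ¬ E a z)

/-- `configs(A)` (Definition 6.4): one candidate configuration per maximal path of `bowtie(A)`. -/
def configsOf (M : NTM) (F : Set Fact) (A : Fact) : Set (Set Fact) :=
  {S | ∃ q : ℕ, ∃ x w : GroundTerm, A = ((pState q, [x, w]) : Fact) ∧
    ∃ l : List GroundTerm, IsMaxPath (bowtieOf F x) (ER F) l ∧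
      S = insert A
        ({f | ∃ z ∈ l, f ∈ brSetF z w} ∪
         {f | f ∈ F ∧ (f.1 = pR ∨ f.1 = pEnd ∨ ∃ a ∈ letters M, f.1 = pLetter a) ∧
           f.2 ≠ [] ∧ f.2.getLast? = some w ∧ ∀ z ∈ f.2.dropLast, z ∈ l})}

/-- Homomorphic embedding of fact sets: a map on nulls (fixing all constants) sending `S`
into `T`. -/
def mapG (h : ℕ → GroundTerm) : GroundTerm → GroundTerm
  | Sum.inl cc => Sum.inl cc
  | Sum.inr n => h n

def mapFact (h : ℕ → GroundTerm) (f : Fact) : Fact := (f.1, f.2.map (mapG h))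

def HomEmbeds (S T : Set Fact) : Prop := ∃ h : ℕ → GroundTerm, ∀ f ∈ S, mapFact h f ∈ T

end ChaseTermination
namespace ChaseTermination

/-! ### The machine `M_Σ` (Definition 4.1), modelled by its canonical runs

A run of `M_Σ` on the encoding of a database corresponds exactly to a restricted chase
derivation of `⟨Σ, D⟩` (step 4 of the procedure) together with the counter `j`; the machine
visits its designated state `q_r` once each time `j` is incremented (step 5), so a run visits
`q_r` infinitely often iff the derivation is infinite and `jseq` is unbounded. -/

open scoped Classical in
/-- The value of the counter `j` of `M_Σ` after `i` iterations of its main loop, when its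
non-deterministic choices build the chase derivation `c`. -/
noncomputable def jseq {S : RuleSet} {D : Set Fact} (c : Chase S D) : ℕ → ℕ
  | 0 => 0
  | i + 1 =>
      if ∀ t : Trigger, Active S (c.fact (jseq c i)) t → obsolete t (c.fact i) then
        jseq c i + 1
      else jseq c i

/-! ### Oblivious and core chase variants -/

/-- A (possibly infinite) oblivious chase derivation: triggers need only be loaded, but no
trigger (instance) is ever applied twice. -/
structure OblChase (S : RuleSet) (D : Set Fact) where
  len : ℕ∞
  fact : ℕ → Set Fact
  trig : ℕ → Trigger
  ext : ℕ → ℕ → GroundTerm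
  init : fact 0 = D
  memAt : ∀ i : ℕ, (i : ℕ∞) < len → (trig i).1 ∈ S
  loadAt : ∀ i : ℕ, (i : ℕ∞) < len → loaded (trig i) (fact i)
  noRepeat : ∀ i j : ℕ, (i : ℕ∞) < len → (j : ℕ∞) < len →
    instOf (trig i) = instOf (trig j) → i = j
  extOk : ∀ i : ℕ, (i : ℕ∞) < len → properExt (trig i) (fact i) (ext i)
  succ : ∀ i : ℕ, (i : ℕ∞) < len → fact (i + 1) = fact i ∪ outputOf (trig i) (ext i)
  stall : ∀ i : ℕ, ¬ ((i : ℕ∞) < len) → fact (i + 1) = fact i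

/-- Fairness for the oblivious chase: every trigger that becomes loaded is eventually applied. -/
def OblFair {S : RuleSet} {D : Set Fact} (c : OblChase S D) : Prop :=
  ∀ t : Trigger, t.1 ∈ S → ∀ i : ℕ, loaded t (c.fact i) →
    ∃ j : ℕ, (j : ℕ∞) < c.len ∧ instOf (c.trig j) = instOf t

/-- `H` is a retract of `G`: `H ⊆ G` and some homomorphism (fixing constants) maps `G` into `H`
leaving `H` pointwise fixed. -/
def RetractOf (G H : Set Fact) : Prop :=
  H ⊆ G ∧ ∃ h : ℕ → GroundTerm, (∀ f ∈ G, mapFact h f ∈ H) ∧ ∀ f ∈ H, mapFact h f = f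

/-- `H` is a core of `G`: a retract of `G` without proper retracts. -/
def IsCoreOf (H G : Set Fact) : Prop := RetractOf G H ∧ ∀ H', RetractOf H H' → H' = H

/-- `G` is obtained from `F` by applying all active triggers in parallel, each with fresh
pairwise distinct nulls (distinct trigger instances use disjoint fresh nulls). -/
def IsParallelStep (S : RuleSet) (F G : Set Fact) : Prop :=
  ∃ pe : Trigger → (ℕ → GroundTerm),
    (∀ t : Trigger, Active S F t → properExt t F (pe t)) ∧
    (∀ t t' : Trigger, Active S F t → Active S F t' → instOf t = instOf t' →
      outputOf t (pe t) = outputOf t' (pe t')) ∧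
    (∀ t t' : Trigger, Active S F t → Active S F t' → instOf t ≠ instOf t' →
      ∀ n : ℕ, (Sum.inr n : GroundTerm) ∉ termsOf F →
        (Sum.inr n : GroundTerm) ∈ termsOf (outputOf t (pe t)) →
        (Sum.inr n : GroundTerm) ∉ termsOf (outputOf t' (pe t'))) ∧
    G = F ∪ ⋃ t ∈ {t : Trigger | Active S F t}, outputOf t (pe t)

/-- A (possibly infinite) core chase sequence: `F_{i+1}` is a core of the parallel application
of all active triggers to `F_i`, and the sequence stops exactly when this is a fixpoint. -/
structure CoreChase (S : RuleSet) (D : Set Fact) where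
  len : ℕ∞
  fact : ℕ → Set Fact
  init : fact 0 = D
  step : ∀ i : ℕ, (i : ℕ∞) < len →
    ∃ G, IsParallelStep S (fact i) G ∧ IsCoreOf (fact (i + 1)) G ∧ fact (i + 1) ≠ fact i
  halt : ∀ i : ℕ, ¬ ((i : ℕ∞) < len) → ∃ G, IsParallelStep S (fact i) G ∧ IsCoreOf (fact i) G
  stall : ∀ i : ℕ, ¬ ((i : ℕ∞) < len) → fact (i + 1) = fact i

/-- The three chase variants. -/
inductive Variant : Type | obl | rest | core

/-- `qExists` ("sometimes") and `qForall` ("always") termination. -/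
inductive Quant : Type | qExists | qForall

/-- `Terminates v q S D`: the knowledge base `⟨S, D⟩` `q`-terminates for the chase variant `v`
(`qExists`: some chase sequence is finite; `qForall`: all chase sequences are finite). -/
def Terminates (v : Variant) (q : Quant) (S : RuleSet) (D : Set Fact) : Prop :=
  match v, q with
  | .rest, .qExists => ∃ c : Chase S D, Fair c ∧ c.len ≠ ⊤
  | .rest, .qForall => ∀ c : Chase S D, Fair c → c.len ≠ ⊤
  | .obl, .qExists => ∃ c : OblChase S D, OblFair c ∧ c.len ≠ ⊤
  | .obl, .qForall => ∀ c : OblChase S D, OblFair c → c.len ≠ ⊤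
  | .core, .qExists => ∃ c : CoreChase S D, c.len ≠ ⊤
  | .core, .qForall => ∀ c : CoreChase S D, c.len ≠ ⊤

end ChaseTermination

namespace ChaseTermination

/-! ### Guarded copies of a knowledge base

The predicates of a knowledge base `⟨S, D⟩` are renamed to codes above `N`, the nullary predicate
`N` is added to every rule body as a guard, and one additional rule with empty body creates
the guard together with the renamed copy of `D`. -/

/-- Rename the predicate of a fact to a code above `N`. -/
def shiftFact (N : ℕ) (f : Fact) : Fact := (f.1 + (N + 1), f.2)

/-- Rename the predicate of an atom to a code above `N`. -/
def shiftAtom (N : ℕ) (a : Atom) : Atom := (a.1 + (N + 1), a.2)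

/-- A fact seen as a variable-free atom. -/
def groundAtom (f : Fact) : Atom := (f.1, f.2.map Sum.inr)

/-- The guarded copy of a rule. -/
def guardRule (N : ℕ) (r : Rule) : Rule :=
  ((N, []) :: r.1.map (shiftAtom N), r.2.map (shiftAtom N))

/-- The rule creating the guard and the renamed copy of `D`. -/
def initRule (N : ℕ) (D : Database) : Rule :=
  ([], (N, []) :: D.map fun f => shiftAtom N (groundAtom f))

/-- The rule set simulating `kb` on databases with predicates below `N`. -/
def guardKB (N : ℕ) (kb : KB) : RuleSet := initRule N kb.2 :: kb.1.map (guardRule N)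

/-- The guarded copy of a trigger. -/
def guardTrigger (N : ℕ) (t : Trigger) : Trigger := (guardRule N t.1, t.2)

/-- The trigger of which a given trigger is a guarded copy, if there is one. -/
noncomputable def unguardTrigger (N : ℕ) (t : Trigger) : Trigger :=
  (Function.invFun (guardRule N) t.1, t.2)

/-- The fact set representing `F` in the simulation over the database `D'`. -/
def guardFacts (N : ℕ) (D' : Database) (F : Set Fact) : Set Fact :=
  insert (N, []) (dbSet D') ∪ shiftFact N '' F

/-- All predicates of `D` are below `N`. -/
def PredsBelow (N : ℕ) (D : Database) : Prop := ∀ f ∈ D, f.1 < N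

theorem shiftFact_injective (N : ℕ) : Function.Injective (shiftFact N) := by
  rintro ⟨p, l⟩ ⟨p', l'⟩ h
  simpa [shiftFact] using h

theorem shiftAtom_injective (N : ℕ) : Function.Injective (shiftAtom N) := by
  rintro ⟨p, l⟩ ⟨p', l'⟩ h
  simpa [shiftAtom] using h

theorem guardRule_injective (N : ℕ) : Function.Injective (guardRule N) := by
  rintro ⟨b, h⟩ ⟨b', h'⟩ e
  simpa [guardRule, List.map_inj_right (shiftAtom_injective N)] using e

theorem guardRule_ne_initRule (N : ℕ) (r : Rule) (D : Database) :
    guardRule N r ≠ initRule N D := by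
  simp [guardRule, initRule]

theorem unguardTrigger_guardTrigger (N : ℕ) (t : Trigger) :
    unguardTrigger N (guardTrigger N t) = t := by
  simp [unguardTrigger, guardTrigger, Function.leftInverse_invFun (guardRule_injective N) t.1]

theorem applyA_shiftAtom (N : ℕ) (σ : ℕ → GroundTerm) (a : Atom) :
    applyA σ (shiftAtom N a) = shiftFact N (applyA σ a) := rfl

theorem applyA_groundAtom (σ : ℕ → GroundTerm) (f : Fact) : applyA σ (groundAtom f) = f := by
  have : applyT σ ∘ (Sum.inr : GroundTerm → RTerm) = id := rfl
  simp [applyA, groundAtom, this]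

theorem atomNullFree_guard (N : ℕ) : atomNullFree (N, []) := by
  simp [atomNullFree]

theorem atomNullFree_shiftAtom (N : ℕ) (a : Atom) :
    atomNullFree (shiftAtom N a) ↔ atomNullFree a := Iff.rfl

theorem atomNullFree_groundAtom (f : Fact) : atomNullFree (groundAtom f) ↔ factNullFree f := by
  simp [atomNullFree, groundAtom, factNullFree]

theorem isRule_guardRule (N : ℕ) (r : Rule) : IsRule (guardRule N r) ↔ IsRule r := by
  simp only [IsRule, guardRule, List.forall_mem_append, List.forall_mem_cons,
    List.forall_mem_map, atomNullFree_shiftAtom, atomNullFree_guard, true_and, ne_eq,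
    List.map_eq_nil_iff]

theorem isRule_initRule (N : ℕ) (D : Database) : IsRule (initRule N D) ↔ IsDatabase D := by
  simp only [IsRule, initRule, List.nil_append, List.forall_mem_cons, List.forall_mem_map,
    atomNullFree_shiftAtom, atomNullFree_groundAtom, atomNullFree_guard, true_and, ne_eq,
    reduceCtorEq, not_false_eq_true, IsDatabase]

theorem isRuleSet_guardKB (N : ℕ) (kb : KB) : IsRuleSet (guardKB N kb) ↔ IsKB kb := by
  simp only [IsRuleSet, guardKB, IsKB, List.forall_mem_cons, List.forall_mem_map,
    isRule_initRule, isRule_guardRule]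
  tauto

section Facts

variable {N : ℕ} {D' : Database}

theorem shiftFact_mem_guardFacts (hN : PredsBelow N D') {F : Set Fact} {f : Fact} :
    shiftFact N f ∈ guardFacts N D' F ↔ f ∈ F := by
  constructor
  · rintro ((h | h) | ⟨g, hg, h⟩)
    · simp [shiftFact] at h
      omega
    · have := hN _ h
      simp [shiftFact] at this
      omega
    · rwa [← shiftFact_injective N h]
  · exact fun h => Or.inr ⟨f, h, rfl⟩

theorem guardFacts_injective (hN : PredsBelow N D') :
    Function.Injective (guardFacts N D') := by
  intro F G h
  ext f
  rw [← shiftFact_mem_guardFacts hN, h, shiftFact_mem_guardFacts hN]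

theorem guard_mem_guardFacts (F : Set Fact) : (N, []) ∈ guardFacts N D' F :=
  Or.inl (Or.inl rfl)

theorem guard_notMem_dbSet (hN : PredsBelow N D') : (N, []) ∉ dbSet D' := fun h =>
  lt_irrefl _ (hN _ h)

theorem guardFacts_union (F X : Set Fact) :
    guardFacts N D' F ∪ shiftFact N '' X = guardFacts N D' (F ∪ X) := by
  simp [guardFacts, Set.image_union, Set.union_assoc]

theorem inr_mem_termsOf_guardFacts (hD' : IsDatabase D') {F : Set Fact} {n : ℕ} :
    (Sum.inr n : GroundTerm) ∈ termsOf (guardFacts N D' F) ↔ Sum.inr n ∈ termsOf F := by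
  constructor
  · rintro ⟨f, (h | h) | ⟨g, hg, rfl⟩, hn⟩
    · rw [h] at hn
      simp at hn
    · exact absurd rfl (hD' f h _ hn n)
    · exact ⟨g, hg, hn⟩
  · rintro ⟨f, hf, hn⟩
    exact ⟨shiftFact N f, Or.inr ⟨f, hf, rfl⟩, hn⟩

theorem termsOf_image_shiftFact (X : Set Fact) : termsOf (shiftFact N '' X) = termsOf X := by
  ext g
  exact Set.exists_mem_image

theorem bodyVar_guardRule (r : Rule) (v : ℕ) : bodyVar (guardRule N r) v ↔ bodyVar r v := by
  simp [bodyVar, guardRule, atomHasVar, shiftAtom]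

theorem existVar_guardRule (r : Rule) (v : ℕ) : existVar (guardRule N r) v ↔ existVar r v := by
  refine and_congr ?_ (not_congr (bodyVar_guardRule r v))
  simp [guardRule, atomHasVar, shiftAtom, -Prod.exists]

theorem agreesOnBody_guardTrigger (t : Trigger) (σ : ℕ → GroundTerm) :
    agreesOnBody (guardTrigger N t) σ ↔ agreesOnBody t σ := by
  simp [agreesOnBody, guardTrigger, bodyVar_guardRule]

theorem properExt_guardTrigger (hD' : IsDatabase D') (t : Trigger) (F : Set Fact)
    (σ : ℕ → GroundTerm) :
    properExt (guardTrigger N t) (guardFacts N D' F) σ ↔ properExt t F σ := by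
  simp only [properExt, agreesOnBody_guardTrigger, inr_mem_termsOf_guardFacts hD']
  simp [guardTrigger, existVar_guardRule]

theorem outputOf_guardTrigger (t : Trigger) (σ : ℕ → GroundTerm) :
    outputOf (guardTrigger N t) σ = shiftFact N '' outputOf t σ := by
  ext f
  simp only [outputOf, guardTrigger, guardRule, List.mem_map, Set.mem_ofPred_eq, Set.mem_image]
  constructor
  · rintro ⟨_, ⟨a, ha, rfl⟩, rfl⟩
    exact ⟨_, ⟨a, ha, rfl⟩, rfl⟩
  · rintro ⟨_, ⟨a, ha, rfl⟩, rfl⟩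
    exact ⟨_, ⟨a, ha, rfl⟩, rfl⟩

theorem loaded_guardTrigger (hN : PredsBelow N D') (t : Trigger) (F : Set Fact) :
    loaded (guardTrigger N t) (guardFacts N D' F) ↔ loaded t F := by
  simp only [loaded, guardTrigger, guardRule, List.forall_mem_cons, List.forall_mem_map,
    applyA_shiftAtom, shiftFact_mem_guardFacts hN]
  exact and_iff_right (guard_mem_guardFacts F)

theorem not_loaded_guardTrigger (hN : PredsBelow N D') (t : Trigger) :
    ¬ loaded (guardTrigger N t) (dbSet D') := fun h =>
  guard_notMem_dbSet hN (h (N, []) (by simp [guardTrigger, guardRule]))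

theorem obsolete_guardTrigger (hN : PredsBelow N D') (t : Trigger) (F : Set Fact) :
    obsolete (guardTrigger N t) (guardFacts N D' F) ↔ obsolete t F := by
  simp only [obsolete, agreesOnBody_guardTrigger]
  simp only [guardTrigger, guardRule, List.forall_mem_map, applyA_shiftAtom,
    shiftFact_mem_guardFacts hN]

theorem instOf_guardTrigger_inj (t u : Trigger) :
    instOf (guardTrigger N t) = instOf (guardTrigger N u) ↔ instOf t = instOf u := by
  have key : ∀ s : Trigger, instOf (guardTrigger N s) =
      (guardRule N s.1, (N, []) :: (s.1.1.map (applyA s.2)).map (shiftFact N)) := by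
    intro s
    simp only [instOf, guardTrigger, guardRule, List.map_cons, List.map_map]
    rfl
  rw [key, key]
  simp [instOf, (guardRule_injective N).eq_iff,
    - List.map_map, (List.map_injective_iff.2 (shiftFact_injective N)).eq_iff]

/-! ### The initial rule -/

variable {S : RuleSet} {D : Database}

theorem guardTrigger_mem_guardKB {t : Trigger} (ht : t.1 ∈ S) :
    (guardTrigger N t).1 ∈ guardKB N (S, D) :=
  List.mem_cons_of_mem _ (List.mem_map_of_mem ht)

theorem mem_guardKB {t : Trigger} (ht : t.1 ∈ guardKB N (S, D)) :
    t.1 = initRule N D ∨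
      (unguardTrigger N t).1 ∈ S ∧ guardTrigger N (unguardTrigger N t) = t := by
  rcases List.mem_cons.1 ht with h | h
  · exact Or.inl h
  · obtain ⟨r, hr, h⟩ := List.mem_map.1 h
    have : t = guardTrigger N (r, t.2) := Prod.ext h.symm rfl
    rw [this, unguardTrigger_guardTrigger]
    exact Or.inr ⟨hr, rfl⟩

theorem guardTrigger_mem_guardKB_iff {t : Trigger} :
    (guardTrigger N t).1 ∈ guardKB N (S, D) ↔ t.1 ∈ S := by
  refine ⟨fun h => ?_, guardTrigger_mem_guardKB⟩
  rcases mem_guardKB h with h | h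
  · exact absurd h (guardRule_ne_initRule N _ D)
  · simpa [unguardTrigger_guardTrigger] using h.1

theorem loaded_of_initRule {t : Trigger} (ht : t.1 = initRule N D) (F : Set Fact) :
    loaded t F := by
  simp [loaded, ht, initRule]

theorem head_initRule_subset {σ : ℕ → GroundTerm} {F : Set Fact} :
    (∀ a ∈ (initRule N D).2, applyA σ a ∈ F) ↔ (N, []) ∈ F ∧ shiftFact N '' dbSet D ⊆ F := by
  simp only [initRule, List.forall_mem_cons, List.forall_mem_map, applyA_shiftAtom,
    applyA_groundAtom, Set.image_subset_iff]
  rfl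

theorem obsolete_of_initRule {t : Trigger} (ht : t.1 = initRule N D) {F : Set Fact}
    (hF : dbSet D ⊆ F) : obsolete t (guardFacts N D' F) := by
  refine ⟨t.2, fun _ _ => rfl, ?_⟩
  rw [ht, head_initRule_subset]
  exact ⟨guard_mem_guardFacts F, fun f hf => Or.inr (Set.image_mono hF hf)⟩

theorem not_obsolete_of_initRule (hN : PredsBelow N D') {t : Trigger}
    (ht : t.1 = initRule N D) : ¬ obsolete t (dbSet D') := by
  rintro ⟨σ, -, h⟩
  rw [ht, head_initRule_subset] at h
  exact guard_notMem_dbSet hN h.1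

theorem properExt_of_initRule {t : Trigger} (ht : t.1 = initRule N D) (F : Set Fact)
    (σ : ℕ → GroundTerm) : properExt t F σ := by
  have hb : ∀ v, ¬ bodyVar t.1 v := by simp [ht, bodyVar, initRule]
  have he : ∀ v, ¬ existVar t.1 v := by
    simp [ht, existVar, initRule, shiftAtom, groundAtom, atomHasVar]
  exact ⟨fun v h => absurd h (hb v), fun v h => absurd h (he v), fun v _ h => absurd h (he v)⟩

theorem instOf_of_initRule {t : Trigger} (ht : t.1 = initRule N D) :
    instOf t = (initRule N D, []) := by
  simp [instOf, ht, initRule]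

theorem outputOf_of_initRule {t : Trigger} (ht : t.1 = initRule N D) (σ : ℕ → GroundTerm) :
    outputOf t σ = insert (N, []) (shiftFact N '' dbSet D) := by
  ext f
  simp only [outputOf, ht, initRule, List.mem_cons, List.mem_map, exists_eq_or_imp,
    Set.mem_ofPred_eq, Set.mem_insert_iff, Set.mem_image]
  refine or_congr Iff.rfl ⟨?_, ?_⟩
  · rintro ⟨_, ⟨a, ha, rfl⟩, rfl⟩
    exact ⟨a, ha, by rw [applyA_shiftAtom, applyA_groundAtom]⟩
  · rintro ⟨a, ha, rfl⟩
    exact ⟨_, ⟨a, ha, rfl⟩, by rw [applyA_shiftAtom, applyA_groundAtom]⟩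

theorem dbSet_union_outputOf_of_initRule {t : Trigger} (ht : t.1 = initRule N D)
    (σ : ℕ → GroundTerm) : dbSet D' ∪ outputOf t σ = guardFacts N D' (dbSet D) := by
  rw [outputOf_of_initRule ht, guardFacts, Set.insert_union, Set.union_insert]

/-! ### Active triggers -/

theorem active_dbSet_iff (hN : PredsBelow N D') {t : Trigger} :
    Active (guardKB N (S, D)) (dbSet D') t ↔ t.1 = initRule N D := by
  refine ⟨fun ⟨hm, hl, _⟩ => ?_, fun h => ⟨?_, loaded_of_initRule h _,
    not_obsolete_of_initRule hN h⟩⟩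
  · rcases mem_guardKB hm with h | h
    · exact h
    · rw [← h.2] at hl
      exact absurd hl (not_loaded_guardTrigger hN _)
  · rw [h]
    exact List.mem_cons_self

theorem active_guardTrigger (hN : PredsBelow N D') {t : Trigger} {F : Set Fact} :
    Active (guardKB N (S, D)) (guardFacts N D' F) (guardTrigger N t) ↔ Active S F t := by
  simp only [Active, guardTrigger_mem_guardKB_iff, loaded_guardTrigger hN,
    obsolete_guardTrigger hN]

theorem guardTrigger_unguardTrigger_of_active {t : Trigger} {F : Set Fact} (hF : dbSet D ⊆ F)
    (ht : Active (guardKB N (S, D)) (guardFacts N D' F) t) :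
    guardTrigger N (unguardTrigger N t) = t := by
  rcases mem_guardKB ht.1 with h | h
  · exact absurd (obsolete_of_initRule h hF) ht.2.2
  · exact h.2

end Facts

/-! ### Derivation lengths -/

theorem natCast_succ_lt_add_one (i : ℕ) (L : ℕ∞) : ((i + 1 : ℕ) : ℕ∞) < L + 1 ↔ (i : ℕ∞) < L := by
  rw [Nat.cast_add, Nat.cast_one, ENat.add_lt_add_iff_right ENat.one_ne_top]

theorem exists_eq_add_one_of_pos {L : ℕ∞} (h : ((0 : ℕ) : ℕ∞) < L) : ∃ L', L = L' + 1 :=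
  ⟨L - 1, (tsub_add_cancel_of_le (Order.one_le_iff_pos.2 (by simpa using h))).symm⟩

theorem add_one_eq_top_iff (L : ℕ∞) : L + 1 = ⊤ ↔ L = ⊤ := by
  simp

section Simulation

variable {N : ℕ} {D' D : Database} {S : RuleSet}

/-! ### The restricted chase -/

theorem exists_fair_guardKB (hN : PredsBelow N D') (hD' : IsDatabase D')
    (c : Chase S (dbSet D)) (hc : Fair c) :
    ∃ c' : Chase (guardKB N (S, D)) (dbSet D'), Fair c' ∧ c'.len = c.len + 1 := by
  have hsub : ∀ i, dbSet D ⊆ c.fact i := by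
    intro i
    induction i with
    | zero => exact c.init.ge
    | succ i ih =>
      by_cases hi : (i : ℕ∞) < c.len
      · rw [c.succ i hi]
        exact ih.trans Set.subset_union_left
      · rwa [c.stall i hi]
  refine ⟨{
    len := c.len + 1
    fact := fun i => i.casesOn (dbSet D') fun i => guardFacts N D' (c.fact i)
    trig := fun i => i.casesOn (initRule N D, fun _ => Sum.inl 0) fun i =>
      guardTrigger N (c.trig i)
    ext := fun i => i.casesOn (fun _ => Sum.inl 0) c.ext
    init := rfl
    activeAt := ?_
    extOk := ?_
    succ := ?_
    stall := ?_ }, ?_, rfl⟩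
  · rintro (_ | i) hi
    · exact (active_dbSet_iff hN).2 rfl
    · exact (active_guardTrigger hN).2 (c.activeAt i ((natCast_succ_lt_add_one _ _).1 hi))
  · rintro (_ | i) hi
    · exact properExt_of_initRule (D := D) rfl _ _
    · exact (properExt_guardTrigger hD' _ _ _).2
        (c.extOk i ((natCast_succ_lt_add_one _ _).1 hi))
  · rintro (_ | i) hi
    · simp only [c.init]
      exact (dbSet_union_outputOf_of_initRule rfl _).symm
    · simp only [outputOf_guardTrigger, guardFacts_union,
        c.succ i ((natCast_succ_lt_add_one _ _).1 hi)]
  · rintro (_ | i) hi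
    · simp at hi
    · simp only [c.stall i (fun h => hi ((natCast_succ_lt_add_one _ _).2 h))]
  · intro t ht i hl
    rcases mem_guardKB ht with h | ⟨hm, h⟩
    · exact ⟨i + 1, Nat.le_succ i, obsolete_of_initRule h (hsub i)⟩
    · rw [← h] at hl ⊢
      cases i with
      | zero => exact absurd hl (not_loaded_guardTrigger hN _)
      | succ i =>
        obtain ⟨j, hij, hj⟩ := hc _ hm i ((loaded_guardTrigger hN _ _).1 hl)
        exact ⟨j + 1, Nat.succ_le_succ hij, (obsolete_guardTrigger hN _ _).2 hj⟩

theorem exists_fair_of_guardKB (hN : PredsBelow N D') (hD' : IsDatabase D')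
    (c : Chase (guardKB N (S, D)) (dbSet D')) (hc : Fair c) :
    ∃ c' : Chase S (dbSet D), Fair c' ∧ c.len = c'.len + 1 := by
  have hpos : ((0 : ℕ) : ℕ∞) < c.len := by
    by_contra h0
    have hst : ∀ i, c.fact i = dbSet D' := by
      intro i
      induction i with
      | zero => exact c.init
      | succ i ih =>
        rw [c.stall i fun h => h0 ((Nat.cast_le.2 (Nat.zero_le i)).trans_lt h), ih]
    obtain ⟨j, -, hj⟩ := hc (initRule N D, fun _ => Sum.inl 0) List.mem_cons_self 0
      (loaded_of_initRule rfl _)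
    rw [hst] at hj
    exact not_obsolete_of_initRule hN rfl hj
  obtain ⟨L, hL⟩ := exists_eq_add_one_of_pos hpos
  have hlt : ∀ i : ℕ, (i : ℕ∞) < L → ((i + 1 : ℕ) : ℕ∞) < c.len := fun i hi => by
    rwa [hL, natCast_succ_lt_add_one]
  have hnlt : ∀ i : ℕ, ¬ (i : ℕ∞) < L → ¬ ((i + 1 : ℕ) : ℕ∞) < c.len := fun i hi => by
    rwa [hL, natCast_succ_lt_add_one]
  have hone : c.fact 1 = guardFacts N D' (dbSet D) := by
    have hact := c.activeAt 0 hpos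
    rw [c.init, active_dbSet_iff hN] at hact
    rw [c.succ 0 hpos, c.init, dbSet_union_outputOf_of_initRule hact]
  have hstep : ∀ i F, dbSet D ⊆ F → c.fact (i + 1) = guardFacts N D' F → (i : ℕ∞) < L →
      Active S F (unguardTrigger N (c.trig (i + 1))) ∧
      properExt (unguardTrigger N (c.trig (i + 1))) F (c.ext (i + 1)) ∧
      c.fact (i + 2) = guardFacts N D'
        (F ∪ outputOf (unguardTrigger N (c.trig (i + 1))) (c.ext (i + 1))) := by
    intro i F hF hi hlen
    have ha := c.activeAt _ (hlt i hlen)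
    have he := c.extOk _ (hlt i hlen)
    have hs := c.succ _ (hlt i hlen)
    rw [hi] at ha he hs
    have hg := guardTrigger_unguardTrigger_of_active hF ha
    rw [← hg] at ha he hs
    rw [outputOf_guardTrigger, guardFacts_union] at hs
    exact ⟨(active_guardTrigger hN).1 ha, (properExt_guardTrigger hD' _ _ _).1 he, hs⟩
  have hfact : ∀ i, ∃ F, dbSet D ⊆ F ∧ c.fact (i + 1) = guardFacts N D' F := by
    intro i
    induction i with
    | zero => exact ⟨_, subset_rfl, hone⟩
    | succ i ih =>
      obtain ⟨F, hF, hi⟩ := ih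
      by_cases hlen : (i : ℕ∞) < L
      · exact ⟨_, hF.trans Set.subset_union_left, (hstep i F hF hi hlen).2.2⟩
      · exact ⟨F, hF, by rw [c.stall _ (hnlt i hlen), hi]⟩
  choose F hF hi using hfact
  have hinj := guardFacts_injective hN
  refine ⟨{
    len := L
    fact := F
    trig := fun i => unguardTrigger N (c.trig (i + 1))
    ext := fun i => c.ext (i + 1)
    init := hinj ((hi 0).symm.trans hone)
    activeAt := fun i h => (hstep i _ (hF i) (hi i) h).1
    extOk := fun i h => (hstep i _ (hF i) (hi i) h).2.1
    succ := fun i h => hinj ((hi (i + 1)).symm.trans (hstep i _ (hF i) (hi i) h).2.2)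
    stall := fun i h => hinj (by rw [← hi, ← hi, c.stall _ (hnlt i h)]) }, ?_, hL⟩
  intro t ht i hl
  obtain ⟨j, hij, hj⟩ := hc (guardTrigger N t) (guardTrigger_mem_guardKB ht) (i + 1)
    (by rw [hi]; exact (loaded_guardTrigger hN _ _).2 hl)
  obtain ⟨k, rfl⟩ : ∃ k, j = k + 1 := ⟨j - 1, by omega⟩
  rw [hi] at hj
  exact ⟨k, Nat.le_of_succ_le_succ hij, (obsolete_guardTrigger hN _ _).1 hj⟩

/-! ### The oblivious chase -/

theorem exists_oblFair_guardKB (hN : PredsBelow N D') (hD' : IsDatabase D')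
    (c : OblChase S (dbSet D)) (hc : OblFair c) :
    ∃ c' : OblChase (guardKB N (S, D)) (dbSet D'), OblFair c' ∧ c'.len = c.len + 1 := by
  have hne : ∀ t : Trigger, instOf (initRule N D, fun _ => Sum.inl 0) ≠
      instOf (guardTrigger N t) := fun t h =>
    guardRule_ne_initRule N t.1 D (congrArg Prod.fst h).symm
  refine ⟨{
    len := c.len + 1
    fact := fun i => i.casesOn (dbSet D') fun i => guardFacts N D' (c.fact i)
    trig := fun i => i.casesOn (initRule N D, fun _ => Sum.inl 0) fun i =>
      guardTrigger N (c.trig i)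
    ext := fun i => i.casesOn (fun _ => Sum.inl 0) c.ext
    init := rfl
    memAt := ?_
    loadAt := ?_
    noRepeat := ?_
    extOk := ?_
    succ := ?_
    stall := ?_ }, ?_, rfl⟩
  · rintro (_ | i) hi
    · exact List.mem_cons_self
    · exact guardTrigger_mem_guardKB (c.memAt i ((natCast_succ_lt_add_one _ _).1 hi))
  · rintro (_ | i) hi
    · exact loaded_of_initRule (D := D) rfl _
    · exact (loaded_guardTrigger hN _ _).2 (c.loadAt i ((natCast_succ_lt_add_one _ _).1 hi))
  · rintro (_ | i) (_ | j) hi hj h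
    · rfl
    · exact absurd h (hne _)
    · exact absurd h.symm (hne _)
    · rw [c.noRepeat i j ((natCast_succ_lt_add_one _ _).1 hi)
        ((natCast_succ_lt_add_one _ _).1 hj) ((instOf_guardTrigger_inj _ _).1 h)]
  · rintro (_ | i) hi
    · exact properExt_of_initRule (D := D) rfl _ _
    · exact (properExt_guardTrigger hD' _ _ _).2
        (c.extOk i ((natCast_succ_lt_add_one _ _).1 hi))
  · rintro (_ | i) hi
    · simp only [c.init]
      exact (dbSet_union_outputOf_of_initRule rfl _).symm
    · simp only [outputOf_guardTrigger, guardFacts_union,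
        c.succ i ((natCast_succ_lt_add_one _ _).1 hi)]
  · rintro (_ | i) hi
    · simp at hi
    · simp only [c.stall i (fun h => hi ((natCast_succ_lt_add_one _ _).2 h))]
  · intro t ht i hl
    rcases mem_guardKB ht with h | ⟨hm, h⟩
    · exact ⟨0, by simp, by rw [instOf_of_initRule h, instOf_of_initRule rfl]⟩
    · rw [← h] at hl ⊢
      cases i with
      | zero => exact absurd hl (not_loaded_guardTrigger hN _)
      | succ i =>
        obtain ⟨j, hlen, hj⟩ := hc _ hm i ((loaded_guardTrigger hN _ _).1 hl)
        exact ⟨j + 1, (natCast_succ_lt_add_one _ _).2 hlen, (instOf_guardTrigger_inj _ _).2 hj⟩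

theorem exists_oblFair_of_guardKB (hN : PredsBelow N D') (hD' : IsDatabase D')
    (c : OblChase (guardKB N (S, D)) (dbSet D')) (hc : OblFair c) :
    ∃ c' : OblChase S (dbSet D), OblFair c' ∧ c.len = c'.len + 1 := by
  have hpos : ((0 : ℕ) : ℕ∞) < c.len := by
    obtain ⟨j, hj, -⟩ := hc (initRule N D, fun _ => Sum.inl 0) List.mem_cons_self 0
      (loaded_of_initRule rfl _)
    exact (Nat.cast_le.2 (Nat.zero_le j)).trans_lt hj
  obtain ⟨L, hL⟩ := exists_eq_add_one_of_pos hpos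
  have hlt : ∀ i : ℕ, (i : ℕ∞) < L → ((i + 1 : ℕ) : ℕ∞) < c.len := fun i hi => by
    rwa [hL, natCast_succ_lt_add_one]
  have hnlt : ∀ i : ℕ, ¬ (i : ℕ∞) < L → ¬ ((i + 1 : ℕ) : ℕ∞) < c.len := fun i hi => by
    rwa [hL, natCast_succ_lt_add_one]
  have hzero : (c.trig 0).1 = initRule N D := by
    have hl := c.loadAt 0 hpos
    rw [c.init] at hl
    rcases mem_guardKB (c.memAt 0 hpos) with h | ⟨-, h⟩
    · exact h
    · rw [← h] at hl
      exact absurd hl (not_loaded_guardTrigger hN _)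
  have hone : c.fact 1 = guardFacts N D' (dbSet D) := by
    rw [c.succ 0 hpos, c.init, dbSet_union_outputOf_of_initRule hzero]
  have htrig : ∀ i : ℕ, (i : ℕ∞) < L → (unguardTrigger N (c.trig (i + 1))).1 ∈ S ∧
      guardTrigger N (unguardTrigger N (c.trig (i + 1))) = c.trig (i + 1) := by
    intro i hi
    rcases mem_guardKB (c.memAt _ (hlt i hi)) with h | h
    · have := c.noRepeat _ _ (hlt i hi) hpos
        ((instOf_of_initRule h).trans (instOf_of_initRule hzero).symm)
      omega
    · exact h
  have hsucc : ∀ i F, c.fact (i + 1) = guardFacts N D' F → (i : ℕ∞) < L →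
      c.fact (i + 2) = guardFacts N D'
        (F ∪ outputOf (unguardTrigger N (c.trig (i + 1))) (c.ext (i + 1))) := by
    intro i F hi hlen
    have hs := c.succ _ (hlt i hlen)
    rwa [hi, ← (htrig i hlen).2, outputOf_guardTrigger, guardFacts_union] at hs
  have hfact : ∀ i, ∃ F, c.fact (i + 1) = guardFacts N D' F := by
    intro i
    induction i with
    | zero => exact ⟨_, hone⟩
    | succ i ih =>
      obtain ⟨F, hi⟩ := ih
      by_cases hlen : (i : ℕ∞) < L
      · exact ⟨_, hsucc i F hi hlen⟩
      · exact ⟨F, by rw [c.stall _ (hnlt i hlen), hi]⟩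
  choose F hi using hfact
  have hinj := guardFacts_injective hN
  refine ⟨{
    len := L
    fact := F
    trig := fun i => unguardTrigger N (c.trig (i + 1))
    ext := fun i => c.ext (i + 1)
    init := hinj ((hi 0).symm.trans hone)
    memAt := fun i h => (htrig i h).1
    loadAt := ?_
    noRepeat := ?_
    extOk := ?_
    succ := fun i h => hinj ((hi (i + 1)).symm.trans (hsucc i _ (hi i) h))
    stall := fun i h => hinj (by rw [← hi, ← hi, c.stall _ (hnlt i h)]) }, ?_, hL⟩
  · intro i h
    have := c.loadAt _ (hlt i h)
    rwa [hi, ← (htrig i h).2, loaded_guardTrigger hN] at this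
  · intro i j h h' he
    have := c.noRepeat _ _ (hlt i h) (hlt j h')
      (by rwa [← (htrig i h).2, ← (htrig j h').2, instOf_guardTrigger_inj])
    omega
  · intro i h
    have := c.extOk _ (hlt i h)
    rwa [hi, ← (htrig i h).2, properExt_guardTrigger hD'] at this
  intro t ht i hl
  obtain ⟨j, hlen, hj⟩ := hc (guardTrigger N t) (guardTrigger_mem_guardKB ht) (i + 1)
    (by rw [hi]; exact (loaded_guardTrigger hN _ _).2 hl)
  cases j with
  | zero =>
    exact absurd ((congrArg Prod.fst hj).symm.trans hzero) (guardRule_ne_initRule N t.1 D)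
  | succ j =>
    have hlen' : (j : ℕ∞) < L := by rwa [hL, natCast_succ_lt_add_one] at hlen
    refine ⟨j, hlen', ?_⟩
    rwa [← (htrig j hlen').2, instOf_guardTrigger_inj] at hj

/-! ### The core chase -/

theorem mapFact_of_factNullFree (h : ℕ → GroundTerm) {f : Fact} (hf : factNullFree f) :
    mapFact h f = f := by
  refine Prod.ext rfl (List.map_congr_left (g := id) (fun t ht => ?_) |>.trans (List.map_id _))
  rcases t with a | n
  · rfl
  · exact absurd rfl (hf _ ht n)

theorem RetractOf.mem_of_factNullFree {G H : Set Fact} (h : RetractOf G H) {f : Fact}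
    (hf : factNullFree f) (hG : f ∈ G) : f ∈ H := by
  obtain ⟨-, m, hm, -⟩ := h
  simpa [mapFact_of_factNullFree m hf] using hm f hG

theorem RetractOf.dbSet_subset {D : Database} (hD : IsDatabase D) {G H : Set Fact}
    (h : RetractOf G H) (hG : dbSet D ⊆ G) : dbSet D ⊆ H := fun f hf =>
  h.mem_of_factNullFree (hD f hf) (hG hf)

theorem RetractOf.eq_of_factNullFree {G H : Set Fact} (hG : ∀ f ∈ G, factNullFree f)
    (h : RetractOf G H) : H = G :=
  h.1.antisymm fun f hf => h.mem_of_factNullFree (hG f hf) hf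

theorem RetractOf.refl (G : Set Fact) : RetractOf G G := by
  have : ∀ f : Fact, mapFact Sum.inr f = f := by
    intro f
    refine Prod.ext rfl (List.map_congr_left (g := id) (fun t ht => ?_) |>.trans (List.map_id _))
    rcases t with a | n <;> rfl
  exact ⟨subset_rfl, Sum.inr, fun f hf => by rwa [this], fun f _ => this f⟩

theorem isCoreOf_iff_of_factNullFree {G H : Set Fact} (hG : ∀ f ∈ G, factNullFree f) :
    IsCoreOf H G ↔ H = G := by
  refine ⟨fun h => h.1.eq_of_factNullFree hG, ?_⟩
  rintro rfl
  exact ⟨RetractOf.refl _, fun H' h => h.eq_of_factNullFree hG⟩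

theorem factNullFree_guard (N : ℕ) : factNullFree (N, []) := by
  simp [factNullFree]

theorem retractOf_guardFacts (hN : PredsBelow N D') (hD' : IsDatabase D') {G X : Set Fact} :
    RetractOf (guardFacts N D' G) X ↔ ∃ H, X = guardFacts N D' H ∧ RetractOf G H := by
  have hbase : ∀ f ∈ insert (N, []) (dbSet D'), factNullFree f := by
    rintro f (rfl | hf)
    · exact factNullFree_guard N
    · exact hD' f hf
  constructor
  · intro h
    have hX : X = guardFacts N D' (shiftFact N ⁻¹' X) := by
      ext f
      constructor
      · intro hf
        rcases h.1 hf with hb | ⟨g, -, rfl⟩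
        · exact Or.inl hb
        · exact Or.inr ⟨g, hf, rfl⟩
      · rintro (hb | ⟨g, hg, rfl⟩)
        · exact h.mem_of_factNullFree (hbase f hb) (Or.inl hb)
        · exact hg
    refine ⟨_, hX, fun f hf => (shiftFact_mem_guardFacts hN).1 (h.1 hf), ?_⟩
    obtain ⟨-, m, hm, hfix⟩ := h
    exact ⟨m, fun f hf => hm _ (Or.inr ⟨f, hf, rfl⟩),
      fun f hf => shiftFact_injective N (hfix _ hf)⟩
  · rintro ⟨H, rfl, hsub, m, hm, hfix⟩
    refine ⟨Set.union_subset_union_right _ (Set.image_mono hsub), m, ?_, ?_⟩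
    · rintro f (hb | ⟨g, hg, rfl⟩)
      · rw [mapFact_of_factNullFree m (hbase f hb)]
        exact Or.inl hb
      · exact Or.inr ⟨_, hm g hg, rfl⟩
    · rintro f (hb | ⟨g, hg, rfl⟩)
      · exact mapFact_of_factNullFree m (hbase f hb)
      · exact congrArg (shiftFact N) (hfix g hg)

theorem isCoreOf_guardFacts (hN : PredsBelow N D') (hD' : IsDatabase D') {G X : Set Fact} :
    IsCoreOf X (guardFacts N D' G) ↔ ∃ H, X = guardFacts N D' H ∧ IsCoreOf H G := by
  simp only [IsCoreOf, retractOf_guardFacts hN hD']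
  constructor
  · rintro ⟨⟨H, rfl, hr⟩, hc⟩
    exact ⟨H, rfl, hr, fun H' h' => guardFacts_injective hN
      (hc _ ((retractOf_guardFacts hN hD').2 ⟨H', rfl, h'⟩))⟩
  · rintro ⟨H, rfl, hr, hc⟩
    refine ⟨⟨H, rfl, hr⟩, fun X hX => ?_⟩
    obtain ⟨H', rfl, h'⟩ := (retractOf_guardFacts hN hD').1 hX
    rw [hc H' h']

theorem isParallelStep_dbSet (hN : PredsBelow N D') {G : Set Fact} :
    IsParallelStep (guardKB N (S, D)) (dbSet D') G ↔ G = guardFacts N D' (dbSet D) := by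
  have hG : ∀ pe : Trigger → ℕ → GroundTerm, dbSet D' ∪
      ⋃ t ∈ {t : Trigger | Active (guardKB N (S, D)) (dbSet D') t}, outputOf t (pe t) =
      guardFacts N D' (dbSet D) := by
    intro pe
    have hne : {t : Trigger | t.1 = initRule N D}.Nonempty :=
      ⟨(initRule N D, fun _ => Sum.inl 0), rfl⟩
    simp only [active_dbSet_iff hN]
    rw [Set.iUnion₂_congr fun t (ht : t ∈ {t : Trigger | t.1 = initRule N D}) =>
        outputOf_of_initRule ht (pe t),
      Set.biUnion_const hne, guardFacts, Set.insert_union, Set.union_insert]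
  constructor
  · rintro ⟨pe, -, -, -, rfl⟩
    exact hG pe
  · rintro rfl
    refine ⟨fun _ _ => Sum.inl 0, ?_, ?_, ?_, (hG _).symm⟩ <;>
      simp only [active_dbSet_iff hN]
    · exact fun t ht => properExt_of_initRule ht _ _
    · exact fun t t' ht ht' _ => by rw [outputOf_of_initRule ht, outputOf_of_initRule ht']
    · exact fun t t' ht ht' h =>
        absurd ((instOf_of_initRule ht).trans (instOf_of_initRule ht').symm) h

theorem isParallelStep_guardFacts (hN : PredsBelow N D') (hD' : IsDatabase D')
    {F X : Set Fact} (hF : dbSet D ⊆ F) :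
    IsParallelStep (guardKB N (S, D)) (guardFacts N D' F) X ↔
      ∃ G, X = guardFacts N D' G ∧ IsParallelStep S F G := by
  have hact : ∀ {P : Trigger → Prop},
      (∀ t, Active (guardKB N (S, D)) (guardFacts N D' F) t → P t) ↔
        ∀ t, Active S F t → P (guardTrigger N t) := by
    intro P
    refine ⟨fun h t ht => h _ ((active_guardTrigger hN).2 ht), fun h t ht => ?_⟩
    have hg := guardTrigger_unguardTrigger_of_active hF ht
    rw [← hg] at ht ⊢
    exact h _ ((active_guardTrigger hN).1 ht)
  have hG : ∀ pe pe' : Trigger → ℕ → GroundTerm, (∀ t, pe' (guardTrigger N t) = pe t) →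
      guardFacts N D' F ∪ ⋃ t ∈ {t : Trigger | Active (guardKB N (S, D)) (guardFacts N D' F) t},
        outputOf t (pe' t) =
      guardFacts N D' (F ∪ ⋃ t ∈ {t : Trigger | Active S F t}, outputOf t (pe t)) := by
    intro pe pe' hpe
    rw [← guardFacts_union]
    congr 1
    apply Set.Subset.antisymm
    · simp only [Set.iUnion₂_subset_iff, Set.mem_ofPred_eq]
      refine hact.2 fun t ht => ?_
      rw [outputOf_guardTrigger, hpe]
      exact Set.image_mono (Set.subset_biUnion_of_mem (u := fun t => outputOf t (pe t)) ht)
    · rw [Set.image_iUnion₂]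
      simp only [Set.iUnion₂_subset_iff, Set.mem_ofPred_eq]
      intro t ht
      rw [← hpe, ← outputOf_guardTrigger]
      exact Set.subset_biUnion_of_mem (u := fun t => outputOf t (pe' t))
        (show Active _ _ _ from (active_guardTrigger hN).2 ht)
  have hcond : ∀ pe pe' : Trigger → ℕ → GroundTerm, (∀ t, pe' (guardTrigger N t) = pe t) →
      (((∀ t : Trigger, Active (guardKB N (S, D)) (guardFacts N D' F) t →
          properExt t (guardFacts N D' F) (pe' t)) ∧
        (∀ t t' : Trigger, Active (guardKB N (S, D)) (guardFacts N D' F) t →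
          Active (guardKB N (S, D)) (guardFacts N D' F) t' → instOf t = instOf t' →
          outputOf t (pe' t) = outputOf t' (pe' t')) ∧
        (∀ t t' : Trigger, Active (guardKB N (S, D)) (guardFacts N D' F) t →
          Active (guardKB N (S, D)) (guardFacts N D' F) t' → instOf t ≠ instOf t' →
          ∀ n : ℕ, (Sum.inr n : GroundTerm) ∉ termsOf (guardFacts N D' F) →
            (Sum.inr n : GroundTerm) ∈ termsOf (outputOf t (pe' t)) →
            (Sum.inr n : GroundTerm) ∉ termsOf (outputOf t' (pe' t')))) ↔
      ((∀ t : Trigger, Active S F t → properExt t F (pe t)) ∧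
        (∀ t t' : Trigger, Active S F t → Active S F t' → instOf t = instOf t' →
          outputOf t (pe t) = outputOf t' (pe t')) ∧
        (∀ t t' : Trigger, Active S F t → Active S F t' → instOf t ≠ instOf t' →
          ∀ n : ℕ, (Sum.inr n : GroundTerm) ∉ termsOf F →
            (Sum.inr n : GroundTerm) ∈ termsOf (outputOf t (pe t)) →
            (Sum.inr n : GroundTerm) ∉ termsOf (outputOf t' (pe t'))))) := by
    intro pe pe' hpe
    have hact₂ : ∀ {P : Trigger → Trigger → Prop},
        (∀ t t', Active (guardKB N (S, D)) (guardFacts N D' F) t →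
          Active (guardKB N (S, D)) (guardFacts N D' F) t' → P t t') ↔
          ∀ t t', Active S F t → Active S F t' → P (guardTrigger N t) (guardTrigger N t') := by
      intro P
      constructor
      · exact fun h t t' ht ht' =>
          h _ _ ((active_guardTrigger hN).2 ht) ((active_guardTrigger hN).2 ht')
      · intro h t t' ht
        revert t'
        rw [hact]
        revert t
        rw [hact]
        exact fun t ht t' ht' => h t t' ht ht'
    rw [hact, hact₂, hact₂]
    simp only [hpe, properExt_guardTrigger hD', instOf_guardTrigger_inj, outputOf_guardTrigger,
      (Set.image_injective.2 (shiftFact_injective N)).eq_iff, termsOf_image_shiftFact,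
      inr_mem_termsOf_guardFacts hD', ne_eq]
  constructor
  · rintro ⟨pe', h₁, h₂, h₃, rfl⟩
    have hpe : ∀ t, pe' (guardTrigger N t) = (fun t => pe' (guardTrigger N t)) t := fun _ => rfl
    obtain ⟨h₁, h₂, h₃⟩ := (hcond _ pe' hpe).1 ⟨h₁, h₂, h₃⟩
    exact ⟨_, hG _ pe' hpe, _, h₁, h₂, h₃, rfl⟩
  · rintro ⟨_, rfl, pe, h₁, h₂, h₃, rfl⟩
    have hpe : ∀ t, (fun t => pe (unguardTrigger N t)) (guardTrigger N t) = pe t := fun t => by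
      simp only [unguardTrigger_guardTrigger]
    obtain ⟨h₁, h₂, h₃⟩ := (hcond pe (fun t => pe (unguardTrigger N t)) hpe).2 ⟨h₁, h₂, h₃⟩
    exact ⟨_, h₁, h₂, h₃, (hG pe (fun t => pe (unguardTrigger N t)) hpe).symm⟩

theorem IsParallelStep.subset {F G : Set Fact} (h : IsParallelStep S F G) : F ⊆ G := by
  obtain ⟨pe, -, -, -, rfl⟩ := h
  exact Set.subset_union_left

theorem factNullFree_guardFacts_dbSet (hD' : IsDatabase D') (hD : IsDatabase D) :
    ∀ f ∈ guardFacts N D' (dbSet D), factNullFree f := by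
  rintro f ((rfl | h) | ⟨g, hg, rfl⟩)
  · exact factNullFree_guard N
  · exact hD' f h
  · exact hD g hg

theorem guardFacts_ne_dbSet (hN : PredsBelow N D') (F : Set Fact) :
    guardFacts N D' F ≠ dbSet D' := fun h =>
  guard_notMem_dbSet hN (h ▸ guard_mem_guardFacts F)

theorem exists_coreChase_guardKB (hN : PredsBelow N D') (hD' : IsDatabase D')
    (hD : IsDatabase D) (c : CoreChase S (dbSet D)) :
    ∃ c' : CoreChase (guardKB N (S, D)) (dbSet D'), c'.len = c.len + 1 := by
  have hsub : ∀ i, dbSet D ⊆ c.fact i := by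
    intro i
    induction i with
    | zero => exact c.init.ge
    | succ i ih =>
      by_cases hi : (i : ℕ∞) < c.len
      · obtain ⟨G, hG, hc, -⟩ := c.step i hi
        exact hc.1.dbSet_subset hD (ih.trans hG.subset)
      · rwa [c.stall i hi]
  refine ⟨{
    len := c.len + 1
    fact := fun i => i.casesOn (dbSet D') fun i => guardFacts N D' (c.fact i)
    init := rfl
    step := ?_
    halt := ?_
    stall := ?_ }, rfl⟩
  · rintro (_ | i) hi
    · refine ⟨_, (isParallelStep_dbSet hN).2 rfl, ?_, guardFacts_ne_dbSet hN _⟩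
      rw [isCoreOf_iff_of_factNullFree (factNullFree_guardFacts_dbSet hD' hD)]
      simp only [c.init]
    · obtain ⟨G, hG, hc, hne⟩ := c.step i ((natCast_succ_lt_add_one _ _).1 hi)
      exact ⟨_, (isParallelStep_guardFacts hN hD' (hsub i)).2 ⟨G, rfl, hG⟩,
        (isCoreOf_guardFacts hN hD').2 ⟨_, rfl, hc⟩, (guardFacts_injective hN).ne hne⟩
  · rintro (_ | i) hi
    · simp at hi
    · obtain ⟨G, hG, hc⟩ := c.halt i (fun h => hi ((natCast_succ_lt_add_one _ _).2 h))
      exact ⟨_, (isParallelStep_guardFacts hN hD' (hsub i)).2 ⟨G, rfl, hG⟩,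
        (isCoreOf_guardFacts hN hD').2 ⟨_, rfl, hc⟩⟩
  · rintro (_ | i) hi
    · simp at hi
    · simp only [c.stall i (fun h => hi ((natCast_succ_lt_add_one _ _).2 h))]

theorem exists_coreChase_of_guardKB (hN : PredsBelow N D') (hD' : IsDatabase D')
    (hD : IsDatabase D) (c : CoreChase (guardKB N (S, D)) (dbSet D')) :
    ∃ c' : CoreChase S (dbSet D), c.len = c'.len + 1 := by
  have hnf := factNullFree_guardFacts_dbSet (N := N) hD' hD
  have hpos : ((0 : ℕ) : ℕ∞) < c.len := by
    by_contra h0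
    obtain ⟨G, hG, hc⟩ := c.halt 0 h0
    rw [c.init, isParallelStep_dbSet hN] at hG
    rw [hG, c.init, isCoreOf_iff_of_factNullFree hnf] at hc
    exact guardFacts_ne_dbSet hN _ hc.symm
  obtain ⟨L, hL⟩ := exists_eq_add_one_of_pos hpos
  have hlt : ∀ i : ℕ, (i : ℕ∞) < L → ((i + 1 : ℕ) : ℕ∞) < c.len := fun i hi => by
    rwa [hL, natCast_succ_lt_add_one]
  have hnlt : ∀ i : ℕ, ¬ (i : ℕ∞) < L → ¬ ((i + 1 : ℕ) : ℕ∞) < c.len := fun i hi => by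
    rwa [hL, natCast_succ_lt_add_one]
  have hone : c.fact 1 = guardFacts N D' (dbSet D) := by
    obtain ⟨G, hG, hc, -⟩ := c.step 0 hpos
    rw [c.init, isParallelStep_dbSet hN] at hG
    rwa [hG, isCoreOf_iff_of_factNullFree hnf] at hc
  have hinj := guardFacts_injective hN
  have hfact : ∀ i, ∃ F, dbSet D ⊆ F ∧ c.fact (i + 1) = guardFacts N D' F := by
    intro i
    induction i with
    | zero => exact ⟨_, subset_rfl, hone⟩
    | succ i ih =>
      obtain ⟨F, hF, hi⟩ := ih
      by_cases hlen : (i : ℕ∞) < L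
      · obtain ⟨X, hX, hc, -⟩ := c.step _ (hlt i hlen)
        rw [hi, isParallelStep_guardFacts hN hD' hF] at hX
        obtain ⟨G, rfl, hG⟩ := hX
        obtain ⟨H, hH, hc⟩ := (isCoreOf_guardFacts hN hD').1 hc
        exact ⟨H, hc.1.dbSet_subset hD (hF.trans hG.subset), hH⟩
      · exact ⟨F, hF, by rw [c.stall _ (hnlt i hlen), hi]⟩
  choose F hF hi using hfact
  have hcore : ∀ {i j X}, IsParallelStep (guardKB N (S, D)) (c.fact (i + 1)) X →
      IsCoreOf (c.fact (j + 1)) X → ∃ G, IsParallelStep S (F i) G ∧ IsCoreOf (F j) G := by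
    intro i j X hX hc
    rw [hi, isParallelStep_guardFacts hN hD' (hF i)] at hX
    obtain ⟨G, rfl, hG⟩ := hX
    obtain ⟨H, hH, hc⟩ := (isCoreOf_guardFacts hN hD').1 hc
    rw [hi] at hH
    exact ⟨G, hG, hinj hH ▸ hc⟩
  refine ⟨{
    len := L
    fact := F
    init := hinj ((hi 0).symm.trans hone)
    step := fun i h => ?_
    halt := fun i h => ?_
    stall := fun i h => hinj (by rw [← hi, ← hi, c.stall _ (hnlt i h)]) }, hL⟩
  · obtain ⟨X, hX, hc, hne⟩ := c.step _ (hlt i h)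
    obtain ⟨G, hG, hc⟩ := hcore hX hc
    exact ⟨G, hG, hc, fun h => hne (by rw [hi, hi, h])⟩
  · obtain ⟨X, hX, hc⟩ := c.halt _ (hnlt i h)
    exact hcore hX hc

/-! ### The reduction -/

theorem terminates_guardKB (hN : PredsBelow N D') (hD' : IsDatabase D') (hD : IsDatabase D)
    (v : Variant) (q : Quant) :
    Terminates v q S (dbSet D) ↔ Terminates v q (guardKB N (S, D)) (dbSet D') := by
  have htop : ∀ {L L' : ℕ∞}, L = L' + 1 → (L ≠ ⊤ ↔ L' ≠ ⊤) := by
    rintro _ L' rfl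
    rw [ne_eq, add_one_eq_top_iff]
  cases v <;> cases q
  · constructor
    · rintro ⟨c, hc, hl⟩
      obtain ⟨c', hc', hl'⟩ := exists_oblFair_guardKB hN hD' c hc
      exact ⟨c', hc', (htop hl').2 hl⟩
    · rintro ⟨c, hc, hl⟩
      obtain ⟨c', hc', hl'⟩ := exists_oblFair_of_guardKB hN hD' c hc
      exact ⟨c', hc', (htop hl').1 hl⟩
  · constructor
    · intro h c hc
      obtain ⟨c', hc', hl'⟩ := exists_oblFair_of_guardKB hN hD' c hc
      exact (htop hl').2 (h c' hc')
    · intro h c hc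
      obtain ⟨c', hc', hl'⟩ := exists_oblFair_guardKB hN hD' c hc
      exact (htop hl').1 (h c' hc')
  · constructor
    · rintro ⟨c, hc, hl⟩
      obtain ⟨c', hc', hl'⟩ := exists_fair_guardKB hN hD' c hc
      exact ⟨c', hc', (htop hl').2 hl⟩
    · rintro ⟨c, hc, hl⟩
      obtain ⟨c', hc', hl'⟩ := exists_fair_of_guardKB hN hD' c hc
      exact ⟨c', hc', (htop hl').1 hl⟩
  · constructor
    · intro h c hc
      obtain ⟨c', hc', hl'⟩ := exists_fair_of_guardKB hN hD' c hc
      exact (htop hl').2 (h c' hc')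
    · intro h c hc
      obtain ⟨c', hc', hl'⟩ := exists_fair_guardKB hN hD' c hc
      exact (htop hl').1 (h c' hc')
  · constructor
    · rintro ⟨c, hl⟩
      obtain ⟨c', hl'⟩ := exists_coreChase_guardKB hN hD' hD c
      exact ⟨c', (htop hl').2 hl⟩
    · rintro ⟨c, hl⟩
      obtain ⟨c', hl'⟩ := exists_coreChase_of_guardKB hN hD' hD c
      exact ⟨c', (htop hl').1 hl⟩
  · constructor
    · intro h c
      obtain ⟨c', hl'⟩ := exists_coreChase_of_guardKB hN hD' hD c
      exact (htop hl').2 (h c')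
    · intro h c
      obtain ⟨c', hl'⟩ := exists_coreChase_guardKB hN hD' hD c
      exact (htop hl').1 (h c')

end Simulation

theorem primrec_shiftAtom (N : ℕ) : Primrec (shiftAtom N) :=
  (Primrec.nat_add.comp Primrec.fst (Primrec.const (N + 1))).pair Primrec.snd

theorem primrec_groundAtom : Primrec groundAtom :=
  Primrec.fst.pair (Primrec.list_map Primrec.snd (Primrec.sumInr.comp Primrec.snd).to₂)

theorem primrec_guardRule (N : ℕ) : Primrec (guardRule N) :=
  (Primrec.list_cons.comp (Primrec.const (N, []))
    (Primrec.list_map Primrec.fst ((primrec_shiftAtom N).comp Primrec.snd).to₂)).pair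
    (Primrec.list_map Primrec.snd ((primrec_shiftAtom N).comp Primrec.snd).to₂)

theorem primrec_initRule (N : ℕ) : Primrec (initRule N) :=
  (Primrec.const []).pair (Primrec.list_cons.comp (Primrec.const (N, []))
    (Primrec.list_map Primrec.id
      ((primrec_shiftAtom N).comp (primrec_groundAtom.comp Primrec.snd)).to₂))

theorem primrec_guardKB (N : ℕ) : Primrec (guardKB N) :=
  Primrec.list_cons.comp ((primrec_initRule N).comp Primrec.snd)
    (Primrec.list_map Primrec.fst ((primrec_guardRule N).comp Primrec.snd).to₂)

theorem exists_predsBelow (D : Database) : ∃ N, PredsBelow N D := by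
  refine ⟨(D.map Prod.fst).sum + 1, fun f hf => ?_⟩
  exact Nat.lt_succ_of_le (List.single_le_sum (fun _ _ => Nat.zero_le _) _
    (List.mem_map_of_mem hf))

/-- For every fixed database `D'`, every quantifier `Q ∈ {∀, ∃}`, and every
chase variant `var ∈ {oblivious, restricted, core}`, there is a many-one reduction from the
class of `Q`-terminating knowledge bases for the `var` chase to the class `CT^var_{D'Q}` of
rule sets `Σ` with `⟨Σ, D'⟩` `Q`-terminating for the `var` chase, and vice versa. -/
theorem kb_ruleset_termination_reductions (D' : Database) (hD' : IsDatabase D')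
    (v : Variant) (q : Quant) :
    (fun kb : KB => IsKB kb ∧ Terminates v q kb.1 (dbSet kb.2)) ≤₀
      (fun S : RuleSet => IsRuleSet S ∧ Terminates v q S (dbSet D')) ∧
    (fun S : RuleSet => IsRuleSet S ∧ Terminates v q S (dbSet D')) ≤₀
      (fun kb : KB => IsKB kb ∧ Terminates v q kb.1 (dbSet kb.2)) := by
  constructor
  · obtain ⟨N, hN⟩ := exists_predsBelow D'
    refine ⟨guardKB N, (primrec_guardKB N).to_comp, fun kb => ?_⟩
    simp only [isRuleSet_guardKB]
    exact and_congr_right fun h => terminates_guardKB hN hD' h.2 v q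
  · refine ⟨fun S => (S, D'), (Primrec.id.pair (Primrec.const D')).to_comp, fun S => ?_⟩
    simp only [IsKB, hD', and_true]

end ChaseTermination
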